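/- arXiv:math/0109140 — 3 statements merged into one kernel-verified Lean document; each statement's English description precedes it below -/
import Mathlib

section
/- With the notation of the setup, fix a sign ε ∈ {+1, −1} and set ε_i = 1 for i ≠ n+1, n+2 and ε_{n+1} = ε_{n+2} = ε. Then the following four K-linear difference operators are equal: (i) (1 − M_{z_{1̄}}D)(1 − M_{z_{2̄}}D)⋯(1 − M_{z_{n̄}}D)·(1 − M_w D²)·(1 − M_{z_n}D)(1 − M_{z_{n−1}}D)⋯(1 − M_{z_1}D), where w(u) = z_{n̄}(u)·z_n(u+1); (ii) (M_{z_1(·+n)} − D)(M_{z_2(·+n−1)} − D)⋯(M_{z_n(·+1)} − D)·(M_{w'} − D²)·(M_{z_{n̄}(·−2)} − D)(M_{z_{\overline{n−1}}(·−3)} − D)⋯(M_{z_{1̄}(·−n−1)} − D), where w'(u) = z_{n̄}(u−1)·z_n(u); (iii) (1 − ε_N M_{x_N}D)(1 − ε_{N−1} M_{x_{N−1}}D)⋯(1 − ε_1 M_{x_1}D); (iv) −(ε_1 M_{x_1(·+n)} − D)(ε_2 M_{x_2(·+n−1)} − D)⋯(ε_N M_{x_N(·+n+1−N)} − D). Moreover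 the middle quadratic factor factorizes: D² − M_{w'} = (M_{x_{n+1}} + εD)·(M_{x_{n+2}(·−1)} + εD). -/
attribute [local instance 10] Classical.propDecidable

noncomputable section

open Finset

variable {K : Type*} [CommRing K]

/-- `Y_a(u)` as a unit of `K`, with `Y_0(u) = 1`, where
`Y_a(u) = Q_a(u - d_a) Q_a(u + d_a)⁻¹`, `d_a = 1/2` for `a < n` and `d_n = 1`. -/
def Yq (n : ℕ) (Q : ℕ → ℂ → Kˣ) (a : ℕ) (u : ℂ) : Kˣ :=
  if a = 0 then 1
  else Q a (u - (if a = n then 1 else 2⁻¹)) * (Q a (u + (if a = n then 1 else 2⁻¹)))⁻¹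

/-- `z_i(u)` for `i = 1,…,2n`, where `i ≤ n` encodes the letter `i` of the alphabet
`J = {1 ≺ ⋯ ≺ n ≺ n̄ ≺ ⋯ ≺ 1̄}`, and `i > n` encodes the letter `\overline{2n+1-i}`. -/
def zq (n : ℕ) (Q : ℕ → ℂ → Kˣ) (i : ℕ) (u : ℂ) : Kˣ :=
  if i ≤ n then
    Yq n Q i (u + (i : ℂ) / 2) * (Yq n Q (i - 1) (u + ((i : ℂ) + 1) / 2))⁻¹
  else
    Yq n Q (2 * n - i) (u + ((i : ℂ) + 2) / 2) *
      (Yq n Q (2 * n + 1 - i) (u + ((i : ℂ) + 3) / 2))⁻¹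

/-- the common value `x_{n+1}(u) = -x_{n+2}(u)
  = Q_n(u+n/2) Q_n(u+(n+4)/2) Q_n(u+(n+2)/2)⁻²`. -/
def xqmid (n : ℕ) (Q : ℕ → ℂ → Kˣ) (u : ℂ) : K :=
  (Q n (u + (n : ℂ) / 2) : K) * (Q n (u + ((n : ℂ) + 4) / 2) : K) *
    (((Q n (u + ((n : ℂ) + 2) / 2))⁻¹ : Kˣ) : K) ^ 2

/-- `x_i(u)` for `i = 1,…,N = 2n+2`. -/
def xq (n : ℕ) (Q : ℕ → ℂ → Kˣ) (i : ℕ) (u : ℂ) : K :=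
  if i ≤ n then zq n Q i u
  else if i = n + 1 then xqmid n Q u
  else if i = n + 2 then -xqmid n Q u
  else zq n Q (i - 2) u

/-- admissibility of a column tableau: whenever `i_k = c` and `i_l = \bar c`
for some `1 ≤ c ≤ n`, one has `n + k - l ≥ c` (letters encoded as in `zq`,
positions `0`-based, which does not change the difference `k - l`). -/
def AdmQ (n : ℕ) {a : ℕ} (t : Fin a → Fin (2 * n)) : Prop :=
  ∀ k l : Fin a, ((t k : ℕ) + 1 ≤ n) → ((t l : ℕ) + 1 = 2 * n + 1 - ((t k : ℕ) + 1)) →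
    (((t k : ℕ) + 1 : ℤ)) ≤ (n : ℤ) + (k : ℕ) - (l : ℕ)

/-- the column tableau sum: `tabSumQ n Q a v = T^{(a)}_1(v)` for `0 ≤ a ≤ n`, i.e.
`T^{(a)}_1(u + 1/2) = ∑ z_{i_1}(u + (a-1)/2) ⋯ z_{i_a}(u - (a-1)/2)` over strictly
increasing admissible tableaux. -/
def tabSumQ (n : ℕ) (Q : ℕ → ℂ → Kˣ) (a : ℕ) (v : ℂ) : K :=
  ∑ t ∈ univ.filter (fun t : Fin a → Fin (2 * n) => StrictMono t ∧ AdmQ n t),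
    ∏ k : Fin a,
      (zq n Q ((t k : ℕ) + 1) (v + ((a : ℂ) - 2 * (((k : ℕ) : ℂ) + 1)) / 2) : K)

/-- `T^{(a)}_1(v)` for all `a ∈ ℤ`: the fundamental `q`-characters for `1 ≤ a ≤ n`,
extended by `T^{(0)}_1 = 1`, `T^{(a)}_1 = 0` for `a < 0`, and
`T^{(a)}_1(u) + T^{(N-a)}_1(u) = 0`. -/
def T1q (n : ℕ) (Q : ℕ → ℂ → Kˣ) (a : ℤ) (v : ℂ) : K :=
  if a < 0 then 0
  else if a ≤ (n : ℤ) then tabSumQ n Q a.toNat v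
  else if a = (n : ℤ) + 1 then 0
  else if a ≤ 2 * (n : ℤ) + 2 then -tabSumQ n Q (2 * (n : ℤ) + 2 - a).toNat v
  else 0

/-- left-to-right composition of a list of difference operators. -/
def opProd (l : List ((ℂ → K) → (ℂ → K))) : (ℂ → K) → (ℂ → K) :=
  l.foldr (· ∘ ·) id

/-- the operator `L(u) = (M_{x_1(⋅+n)} - D)(M_{x_2(⋅+n-1)} - D) ⋯ (M_{x_N(⋅+n+1-N)} - D)`,
where `D` is the shift `(Df)(u) = f(u+1)` and `M_g` is multiplication by `g`. -/
def Lq (n : ℕ) (Q : ℕ → ℂ → Kˣ) : (ℂ → K) → (ℂ → K) :=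
  opProd ((List.range (2 * n + 2)).map fun j =>
    fun f u => xq n Q (j + 1) (u + (n : ℂ) - (j : ℂ)) * f u - f (u + 1))

/-- `ε_i = -1` for `i = n+1, n+2` and `= 1` otherwise. -/
def epsq (n : ℕ) (i : ℕ) : K := if i = n + 1 ∨ i = n + 2 then -1 else 1

/-- `L_j`, the left-to-right composition over `i = N+1-j, …, N` of the operators
`D - ε_i M_{x_i(⋅+n+1-i)}`. -/
def Ljq (n : ℕ) (Q : ℕ → ℂ → Kˣ) (j : ℕ) : (ℂ → K) → (ℂ → K) :=
  opProd ((List.range j).map fun r =>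
    fun f u => f (u + 1) -
      epsq n (2 * n + 3 - j + r) * xq n Q (2 * n + 3 - j + r)
        (u + (n : ℂ) + 1 - ((2 * n + 3 - j + r : ℕ) : ℂ)) * f u)

/-- the Casorati determinant `det_{1 ≤ r,s ≤ j} (w_r(u + s - 1))`
(for a family `w` indexed by `1, 2, …`). -/
def casq (w : ℕ → ℂ → K) (j : ℕ) (u : ℂ) : K :=
  Matrix.det (Matrix.of fun r s : Fin j => w ((r : ℕ) + 1) (u + ((s : ℕ) : ℂ)))

/-- `ξ^{(a)}_m(u)`: the determinant of the `N × N` matrix whose columns are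
`(w_j(u+c))_j` for `c` running over `(0, 1, …, a-1, a+m, a+m+1, …, N+m-1)`. -/
def xiq (n : ℕ) (w : ℕ → ℂ → K) (a m : ℕ) (u : ℂ) : K :=
  Matrix.det (Matrix.of fun j r : Fin (2 * n + 2) =>
    w ((j : ℕ) + 1) (u + ((if (r : ℕ) < a then (r : ℕ) else (r : ℕ) + m : ℕ) : ℂ)))

/-- the operator
`(1 - M_{z_{1̄}}D) ⋯ (1 - M_{z_{n̄}}D) ⋅ (1 - M_w D²) ⋅ (1 - M_{z_n}D) ⋯ (1 - M_{z_1}D)`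
with `w(u) = z_{n̄}(u) z_n(u+1)`. -/
def opFormI (n : ℕ) (Q : ℕ → ℂ → Kˣ) : (ℂ → K) → (ℂ → K) :=
  opProd ((List.range n).map fun b =>
      fun f u => f u - (zq n Q (2 * n - b) u : K) * f (u + 1)) ∘
    (fun f u => f u - (zq n Q (n + 1) u : K) * (zq n Q n (u + 1) : K) * f (u + 2)) ∘
    opProd ((List.range n).map fun b =>
      fun f u => f u - (zq n Q (n - b) u : K) * f (u + 1))

/-- the operator
`(M_{z_1(⋅+n)} - D) ⋯ (M_{z_n(⋅+1)} - D) ⋅ (M_{w'} - D²) ⋅ (M_{z_{n̄}(⋅-2)} - D) ⋯ (M_{z_{1̄}(⋅-n-1)} - D)`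
with `w'(u) = z_{n̄}(u-1) z_n(u)`. -/
def opFormII (n : ℕ) (Q : ℕ → ℂ → Kˣ) : (ℂ → K) → (ℂ → K) :=
  opProd ((List.range n).map fun b =>
      fun f u => (zq n Q (b + 1) (u + (n : ℂ) - (b : ℂ)) : K) * f u - f (u + 1)) ∘
    (fun f u => (zq n Q (n + 1) (u - 1) : K) * (zq n Q n u : K) * f u - f (u + 2)) ∘
    opProd ((List.range n).map fun b =>
      fun f u => (zq n Q (n + 1 + b) (u - 2 - (b : ℂ)) : K) * f u - f (u + 1))

/-- the operator `(1 - ε_N M_{x_N}D)(1 - ε_{N-1} M_{x_{N-1}}D) ⋯ (1 - ε_1 M_{x_1}D)`. -/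
def opFormIII (n : ℕ) (Q : ℕ → ℂ → Kˣ) (ε : K) : (ℂ → K) → (ℂ → K) :=
  opProd ((List.range (2 * n + 2)).map fun j =>
    fun f u => f u -
      (if 2 * n + 2 - j = n + 1 ∨ 2 * n + 2 - j = n + 2 then ε else 1) *
        xq n Q (2 * n + 2 - j) u * f (u + 1))

/-- the operator `-(ε_1 M_{x_1(⋅+n)} - D)(ε_2 M_{x_2(⋅+n-1)} - D) ⋯ (ε_N M_{x_N(⋅+n+1-N)} - D)`. -/
def opFormIV (n : ℕ) (Q : ℕ → ℂ → Kˣ) (ε : K) : (ℂ → K) → (ℂ → K) :=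
  fun f u =>
    -(opProd ((List.range (2 * n + 2)).map fun j =>
        fun g v => (if j + 1 = n + 1 ∨ j + 1 = n + 2 then ε else 1) *
          xq n Q (j + 1) (v + (n : ℂ) - (j : ℂ)) * g v - g (v + 1)) f u)

theorem opProd_append (l l' : List ((ℂ → K) → (ℂ → K))) :
    opProd (l ++ l') = opProd l ∘ opProd l' := by
  induction l with
  | nil => rfl
  | cons A l ih => exact congrArg (A ∘ ·) ih

theorem opProd_map_range_succ (A : ℕ → (ℂ → K) → (ℂ → K)) (k : ℕ) :
    opProd ((List.range (k + 1)).map A) = opProd ((List.range k).map A) ∘ A k := by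
  rw [List.range_succ, List.map_append, opProd_append]
  rfl

/-- A product over `2n+2` indices splits into the first `n`, the middle two and the last `n`. -/
theorem opProd_map_range_split (A : ℕ → (ℂ → K) → (ℂ → K)) (n : ℕ) :
    opProd ((List.range (2 * n + 2)).map A) =
      opProd ((List.range n).map A) ∘ (A n ∘ A (n + 1)) ∘
        opProd ((List.range n).map fun b => A (n + 2 + b)) := by
  rw [show 2 * n + 2 = (n + 2) + n by ring, List.range_add, List.map_append, opProd_append,
    opProd_map_range_succ, opProd_map_range_succ, List.map_map]
  rfl

/-- Intertwining relations between factors telescope to one between products. -/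
theorem opProd_intertwine (A B m : ℕ → (ℂ → K) → (ℂ → K)) (k : ℕ)
    (h : ∀ b < k, A b ∘ m (b + 1) = m b ∘ B b) :
    opProd ((List.range k).map A) ∘ m k = m 0 ∘ opProd ((List.range k).map B) := by
  induction k with
  | zero => rfl
  | succ k ih =>
    rw [opProd_map_range_succ, opProd_map_range_succ, Function.comp_assoc, h k k.lt_succ_self,
      ← Function.comp_assoc, ih fun b hb => h b (hb.trans k.lt_succ_self), Function.comp_assoc]

/-- Multiplication by a unit-valued function. -/
def unitMulOp (g : ℂ → Kˣ) (f : ℂ → K) (u : ℂ) : K := g u * f u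

theorem zq_unbarred (n : ℕ) (Q : ℕ → ℂ → Kˣ) (b : ℕ) (hb : b < n) (u : ℂ) :
    zq n Q (b + 1) u =
      Yq n Q (b + 1) (u + ((b : ℂ) + 1) / 2) * (Yq n Q b (u + ((b : ℂ) + 2) / 2))⁻¹ := by
  rw [zq, if_pos (by omega), Nat.add_sub_cancel]
  push_cast
  ring_nf

theorem zq_barred (n : ℕ) (Q : ℕ → ℂ → Kˣ) (b : ℕ) (hb : b < n) (u : ℂ) :
    zq n Q (2 * n - b) u =
      Yq n Q b (u + (n : ℂ) + 1 - (b : ℂ) / 2) *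
        (Yq n Q (b + 1) (u + (n : ℂ) + 3 / 2 - (b : ℂ) / 2))⁻¹ := by
  rw [zq, if_neg (by omega), show 2 * n - (2 * n - b) = b by omega,
    show 2 * n + 1 - (2 * n - b) = b + 1 by omega, Nat.cast_sub (by omega)]
  push_cast
  ring_nf

/-- The left gauge factor `c_a(u) = Y_a(u + n + 1 - a/2)`. -/
def leftGauge (n : ℕ) (Q : ℕ → ℂ → Kˣ) (a : ℕ) (u : ℂ) : Kˣ :=
  Yq n Q a (u + (n : ℂ) + 1 - (a : ℂ) / 2)

/-- The right gauge factor `β_a(u) = Y_a(u + a/2)⁻¹`. -/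
def rightGauge (n : ℕ) (Q : ℕ → ℂ → Kˣ) (a : ℕ) (u : ℂ) : Kˣ :=
  (Yq n Q a (u + (a : ℂ) / 2))⁻¹

theorem unitMulOp_leftGauge_zero (n : ℕ) (Q : ℕ → ℂ → Kˣ) :
    unitMulOp (leftGauge n Q 0) = id := by
  funext f u
  simp [unitMulOp, leftGauge, Yq]

theorem unitMulOp_rightGauge_zero (n : ℕ) (Q : ℕ → ℂ → Kˣ) :
    unitMulOp (rightGauge n Q 0) = id := by
  funext f u
  simp [unitMulOp, rightGauge, Yq]

theorem leftGauge_succ (n : ℕ) (Q : ℕ → ℂ → Kˣ) (b : ℕ) (hb : b < n) (u : ℂ) :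
    leftGauge n Q (b + 1) u = leftGauge n Q b u * zq n Q (b + 1) (u + (n : ℂ) - (b : ℂ)) := by
  rw [zq_unbarred n Q b hb, leftGauge, leftGauge,
    show u + (n : ℂ) - b + ((b : ℂ) + 2) / 2 = u + (n : ℂ) + 1 - (b : ℂ) / 2 by ring,
    mul_comm, inv_mul_cancel_right]
  push_cast
  ring_nf

theorem leftGauge_eq_barred_mul (n : ℕ) (Q : ℕ → ℂ → Kˣ) (b : ℕ) (hb : b < n) (u : ℂ) :
    leftGauge n Q b u = zq n Q (2 * n - b) u * leftGauge n Q (b + 1) (u + 1) := by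
  rw [zq_barred n Q b hb, leftGauge, leftGauge, Nat.cast_succ,
    show u + 1 + (n : ℂ) + 1 - ((b : ℂ) + 1) / 2 = u + (n : ℂ) + 3 / 2 - (b : ℂ) / 2 by ring,
    inv_mul_cancel_right]

theorem rightGauge_succ (n : ℕ) (Q : ℕ → ℂ → Kˣ) (b : ℕ) (hb : b < n) (u : ℂ) :
    rightGauge n Q (b + 1) u =
      zq n Q (2 * n - b) (u - (n : ℂ) - 1 + (b : ℂ)) * rightGauge n Q b u := by
  rw [zq_barred n Q b hb, rightGauge, rightGauge,
    show u - (n : ℂ) - 1 + (b : ℂ) + n + 1 - (b : ℂ) / 2 = u + (b : ℂ) / 2 by ring,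
    mul_comm, inv_mul_cancel_left]
  push_cast
  ring_nf

theorem rightGauge_add_one (n : ℕ) (Q : ℕ → ℂ → Kˣ) (b : ℕ) (hb : b < n) (u : ℂ) :
    rightGauge n Q b (u + 1) = rightGauge n Q (b + 1) u * zq n Q (b + 1) u := by
  rw [zq_unbarred n Q b hb, rightGauge, rightGauge, Nat.cast_succ, inv_mul_cancel_left]
  ring_nf

/-- `(1 - M_{z_ā} D) M_{c_a} = M_{c_{a-1}} (M_{z_a(⋅+n+1-a)} - D)` with `a = b + 1`. -/
theorem left_factor_intertwine (n : ℕ) (Q : ℕ → ℂ → Kˣ) (b : ℕ) (hb : b < n) :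
    (fun (f : ℂ → K) u => f u - (zq n Q (2 * n - b) u : K) * f (u + 1)) ∘
        unitMulOp (leftGauge n Q (b + 1)) =
      unitMulOp (leftGauge n Q b) ∘
        fun f u => (zq n Q (b + 1) (u + (n : ℂ) - (b : ℂ)) : K) * f u - f (u + 1) := by
  funext f u
  have h₁ := congrArg Units.val (leftGauge_succ n Q b hb u)
  have h₂ := congrArg Units.val (leftGauge_eq_barred_mul n Q b hb u)
  simp only [Units.val_mul] at h₁ h₂
  simp only [Function.comp_apply, unitMulOp]
  linear_combination f u * h₁ + f (u + 1) * h₂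

/-- `(M_{z_ā(⋅-n-2+a)} - D) M_{β_{a-1}} = M_{β_a} (1 - M_{z_a} D)` with `a = b + 1`. -/
theorem right_factor_intertwine (n : ℕ) (Q : ℕ → ℂ → Kˣ) (b : ℕ) (hb : b < n) :
    (fun (f : ℂ → K) u =>
        (zq n Q (2 * n - b) (u - (n : ℂ) - 1 + (b : ℂ)) : K) * f u - f (u + 1)) ∘
        unitMulOp (rightGauge n Q b) =
      unitMulOp (rightGauge n Q (b + 1)) ∘
        fun f u => f u - (zq n Q (b + 1) u : K) * f (u + 1) := by
  funext f u
  have h₁ := congrArg Units.val (rightGauge_succ n Q b hb u)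
  have h₂ := congrArg Units.val (rightGauge_add_one n Q b hb u)
  simp only [Units.val_mul] at h₁ h₂
  simp only [Function.comp_apply, unitMulOp]
  linear_combination -f u * h₁ - f (u + 1) * h₂

/-- `z_{n̄}(u) z_n(u+1) = Y_n(u + n/2 + 1) Y_n(u + n/2 + 2)⁻¹`. -/
theorem zq_middle (n : ℕ) (hn : 0 < n) (Q : ℕ → ℂ → Kˣ) (u : ℂ) :
    zq n Q (n + 1) u * zq n Q n (u + 1) =
      Yq n Q n (u + (n : ℂ) / 2 + 1) * (Yq n Q n (u + (n : ℂ) / 2 + 2))⁻¹ := by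
  rw [zq, zq, if_neg (by omega), if_pos le_rfl, show 2 * n - (n + 1) = n - 1 by omega,
    show 2 * n + 1 - (n + 1) = n by omega, Nat.cast_succ,
    show u + 1 + ((n : ℂ) + 1) / 2 = u + ((n : ℂ) + 1 + 2) / 2 by ring,
    show u + 1 + (n : ℂ) / 2 = u + (n : ℂ) / 2 + 1 by ring,
    show u + ((n : ℂ) + 1 + 3) / 2 = u + (n : ℂ) / 2 + 2 by ring,
    mul_comm, mul_assoc, inv_mul_cancel_left]

theorem middle_gauge (n : ℕ) (hn : 0 < n) (Q : ℕ → ℂ → Kˣ) :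
    (fun (f : ℂ → K) u =>
        f u - (zq n Q (n + 1) u : K) * (zq n Q n (u + 1) : K) * f (u + 2)) =
      unitMulOp (leftGauge n Q n) ∘
        (fun f u => (zq n Q (n + 1) (u - 1) : K) * (zq n Q n u : K) * f u - f (u + 2)) ∘
        unitMulOp (rightGauge n Q n) := by
  funext f u
  have h₁ : zq n Q (n + 1) u * zq n Q n (u + 1) =
      leftGauge n Q n u * rightGauge n Q n (u + 2) := by
    rw [zq_middle n hn, leftGauge, rightGauge]
    ring_nf
  have h₂ : leftGauge n Q n u * (zq n Q (n + 1) (u - 1) * zq n Q n u) *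
      rightGauge n Q n u = 1 := by
    have h := zq_middle n hn Q (u - 1)
    rw [sub_add_cancel, show u - 1 + (n : ℂ) / 2 + 1 = u + (n : ℂ) / 2 by ring] at h
    rw [h, leftGauge, rightGauge,
      show u - 1 + (n : ℂ) / 2 + 2 = u + (n : ℂ) + 1 - (n : ℂ) / 2 by ring]
    rw [mul_comm (Yq n Q n (u + (n : ℂ) / 2)), mul_inv_cancel_left, mul_inv_cancel]
  replace h₁ := congrArg Units.val h₁
  replace h₂ := congrArg Units.val h₂
  simp only [Units.val_mul, Units.val_one] at h₁ h₂
  simp only [Function.comp_apply, unitMulOp]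
  linear_combination -f (u + 2) * h₁ - f u * h₂

theorem opFormI_eq_opFormII (n : ℕ) (hn : 0 < n) (Q : ℕ → ℂ → Kˣ) :
    opFormI n Q = opFormII n Q := by
  have hL := opProd_intertwine _ _ (fun a => unitMulOp (leftGauge n Q a)) n
    fun b hb => left_factor_intertwine n Q b hb
  have hR := opProd_intertwine
    (fun b (f : ℂ → K) u => (zq n Q (n + 1 + b) (u - 2 - (b : ℂ)) : K) * f u - f (u + 1))
    (fun b (f : ℂ → K) u => f u - (zq n Q (n - b) u : K) * f (u + 1))
    (fun b => unitMulOp (rightGauge n Q (n - b))) n (by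
      intro b hb
      have h := right_factor_intertwine n Q (n - (b + 1)) (by omega)
      rw [show 2 * n - (n - (b + 1)) = n + 1 + b by omega,
        show n - (b + 1) + 1 = n - b by omega] at h
      rw [← h]
      funext f u
      rw [Nat.cast_sub (by omega : b + 1 ≤ n)]
      simp only [Function.comp_apply]
      push_cast
      ring_nf)
  simp only [Nat.sub_self, Nat.sub_zero, unitMulOp_leftGauge_zero, unitMulOp_rightGauge_zero,
    Function.comp_id, Function.id_comp] at hL hR
  rw [opFormI, opFormII, middle_gauge n hn, hR, ← hL]
  rfl

/-- `x_{n+1}(u) x_{n+1}(u+1) = z_{n̄}(u) z_n(u+1)`. -/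
theorem xqmid_mul_xqmid (n : ℕ) (hn : 0 < n) (Q : ℕ → ℂ → Kˣ) (u : ℂ) :
    xqmid n Q u * xqmid n Q (u + 1) =
      (zq n Q (n + 1) u : K) * (zq n Q n (u + 1) : K) := by
  rw [← Units.val_mul, zq_middle n hn]
  simp only [xqmid, Yq, if_neg hn.ne', if_true, mul_inv, inv_inv]
  rw [show u + (n : ℂ) / 2 + 1 - 1 = u + (n : ℂ) / 2 by ring,
    show u + (n : ℂ) / 2 + 1 + 1 = u + (n : ℂ) / 2 + 2 by ring,
    show u + (n : ℂ) / 2 + 2 - 1 = u + (n : ℂ) / 2 + 1 by ring,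
    show u + (n : ℂ) / 2 + 2 + 1 = u + (n : ℂ) / 2 + 3 by ring,
    show u + ((n : ℂ) + 4) / 2 = u + (n : ℂ) / 2 + 2 by ring,
    show u + ((n : ℂ) + 2) / 2 = u + (n : ℂ) / 2 + 1 by ring,
    show u + 1 + (n : ℂ) / 2 = u + (n : ℂ) / 2 + 1 by ring,
    show u + 1 + ((n : ℂ) + 4) / 2 = u + (n : ℂ) / 2 + 3 by ring,
    show u + 1 + ((n : ℂ) + 2) / 2 = u + (n : ℂ) / 2 + 2 by ring]
  have h : ∀ a b c d : Kˣ,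
      a * c * (b⁻¹) ^ 2 * (b * d * (c⁻¹) ^ 2) = a * c⁻¹ * (b⁻¹ * d) := by
    intro a b c d
    calc _ = a * c⁻¹ * (b⁻¹ * d) * (c * c⁻¹) * (b * b⁻¹) := by
          simp only [pow_two]; ac_rfl
      _ = _ := by simp
  exact_mod_cast congrArg Units.val (h _ _ _ _)

theorem xq_of_le (n : ℕ) (Q : ℕ → ℂ → Kˣ) (i : ℕ) (hi : i ≤ n) (u : ℂ) :
    xq n Q i u = (zq n Q i u : K) := if_pos hi

theorem xq_middle_fst (n : ℕ) (Q : ℕ → ℂ → Kˣ) (u : ℂ) : xq n Q (n + 1) u = xqmid n Q u := by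
  simp [xq]

theorem xq_middle_snd (n : ℕ) (Q : ℕ → ℂ → Kˣ) (u : ℂ) : xq n Q (n + 2) u = -xqmid n Q u := by
  simp [xq]

theorem xq_of_gt (n : ℕ) (Q : ℕ → ℂ → Kˣ) (i : ℕ) (hi : n + 2 < i) (u : ℂ) :
    xq n Q i u = (zq n Q (i - 2) u : K) := by
  rw [xq, if_neg (by omega), if_neg (by omega), if_neg (by omega)]

theorem opFormI_eq_opFormIII (n : ℕ) (hn : 0 < n) (Q : ℕ → ℂ → Kˣ) (ε : K)
    (hε : ε * ε = 1) : opFormI n Q = opFormIII n Q ε := by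
  rw [opFormI, opFormIII, opProd_map_range_split]
  congr 1
  · refine congrArg opProd (List.map_congr_left fun b hb => funext₂ fun f u => ?_)
    rw [List.mem_range] at hb
    rw [if_neg (by omega), xq_of_gt _ _ _ (by omega),
      show 2 * n + 2 - b - 2 = 2 * n - b by omega, one_mul]
  congr 1
  · funext f u
    simp only [Function.comp_apply]
    rw [show 2 * n + 2 - n = n + 2 by omega, show 2 * n + 2 - (n + 1) = n + 1 by omega,
      if_pos (Or.inr rfl), if_pos (Or.inl rfl), xq_middle_fst, xq_middle_fst, xq_middle_snd,
      ← xqmid_mul_xqmid n hn, show u + 1 + 1 = u + 2 by ring]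
    linear_combination (xqmid n Q u * xqmid n Q (u + 1) * f (u + 2)) * hε
  · refine congrArg opProd (List.map_congr_left fun b hb => funext₂ fun f u => ?_)
    rw [List.mem_range] at hb
    rw [show 2 * n + 2 - (n + 2 + b) = n - b by omega, if_neg (by omega),
      xq_of_le _ _ _ (by omega), one_mul]

theorem opFormII_eq_opFormIV (n : ℕ) (hn : 0 < n) (Q : ℕ → ℂ → Kˣ) (ε : K)
    (hε : ε * ε = 1) : opFormII n Q = opFormIV n Q ε := by
  have hL := opProd_intertwine
    (fun b (f : ℂ → K) u => (zq n Q (b + 1) (u + (n : ℂ) - (b : ℂ)) : K) * f u - f (u + 1))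
    (fun j g v => (if j + 1 = n + 1 ∨ j + 1 = n + 2 then ε else 1) *
      xq n Q (j + 1) (v + (n : ℂ) - (j : ℂ)) * g v - g (v + 1))
    (fun _ => Neg.neg) n fun b hb => by
      funext f u
      simp only [Function.comp_apply, Pi.neg_apply]
      rw [if_neg (by omega), xq_of_le _ _ _ (by omega)]
      ring
  have hIV : opFormIV n Q ε = Neg.neg ∘ opProd ((List.range (2 * n + 2)).map fun j =>
        fun g v => (if j + 1 = n + 1 ∨ j + 1 = n + 2 then ε else 1) *
          xq n Q (j + 1) (v + (n : ℂ) - (j : ℂ)) * g v - g (v + 1)) := rfl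
  rw [hIV, opFormII, opProd_map_range_split, ← Function.comp_assoc Neg.neg,
    ← hL, Function.comp_assoc]
  congr 1
  rw [← Function.comp_assoc Neg.neg]
  congr 1
  · funext f u
    have h := xqmid_mul_xqmid n hn Q (u - 1)
    rw [sub_add_cancel] at h
    simp only [Function.comp_apply, Pi.neg_apply, true_or, or_true, if_true]
    rw [xq_middle_fst, xq_middle_snd, xq_middle_snd,
      Nat.cast_succ, show u + 1 + (n : ℂ) - ((n : ℂ) + 1) = u by ring,
      show u + (n : ℂ) - ((n : ℂ) + 1) = u - 1 by ring, add_sub_cancel_right,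
      show u + 1 + 1 = u + 2 by ring]
    linear_combination -f u * h - (xqmid n Q (u - 1) * xqmid n Q u * f u) * hε
  · refine congrArg opProd (List.map_congr_left fun b hb => funext₂ fun f u => ?_)
    rw [List.mem_range] at hb
    rw [if_neg (by omega), xq_of_gt _ _ _ (by omega),
      show n + 2 + b + 1 - 2 = n + 1 + b by omega, one_mul]
    push_cast
    ring_nf

theorem middle_factorization (n : ℕ) (hn : 0 < n) (Q : ℕ → ℂ → Kˣ) (ε : K)
    (hε : ε * ε = 1) :
    (fun (f : ℂ → K) (u : ℂ) =>
        f (u + 2) - (zq n Q (n + 1) (u - 1) : K) * (zq n Q n u : K) * f u) =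
      (fun (f : ℂ → K) (u : ℂ) => xq n Q (n + 1) u * f u + ε * f (u + 1)) ∘
        (fun (f : ℂ → K) (u : ℂ) => xq n Q (n + 2) (u - 1) * f u + ε * f (u + 1)) := by
  funext f u
  have h := xqmid_mul_xqmid n hn Q (u - 1)
  rw [sub_add_cancel] at h
  simp only [Function.comp_apply, xq_middle_fst, xq_middle_snd]
  rw [add_sub_cancel_right, show u + 1 + 1 = u + 2 by ring]
  linear_combination f u * h - f (u + 2) * hε

/-- Lemma 2.1: the four factorized forms of the difference operator `L(u)` coincide,
and the middle quadratic factor factorizes as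
`D² - M_{w'} = (M_{x_{n+1}} + εD)(M_{x_{n+2}(⋅-1)} + εD)`. -/
theorem statement0 {K : Type*} [CommRing K] (n : ℕ) (hn : 2 ≤ n) (Q : ℕ → ℂ → Kˣ)
    (ε : K) (hε : ε = 1 ∨ ε = -1) :
    opFormI n Q = opFormII n Q ∧
    opFormII n Q = opFormIII n Q ε ∧
    opFormIII n Q ε = opFormIV n Q ε ∧
    (fun (f : ℂ → K) (u : ℂ) =>
        f (u + 2) - (zq n Q (n + 1) (u - 1) : K) * (zq n Q n u : K) * f u) =
      (fun (f : ℂ → K) (u : ℂ) => xq n Q (n + 1) u * f u + ε * f (u + 1)) ∘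
        (fun (f : ℂ → K) (u : ℂ) => xq n Q (n + 2) (u - 1) * f u + ε * f (u + 1)) := by
  have hn₀ : 0 < n := by omega
  have hε₂ : ε * ε = 1 := by rcases hε with rfl | rfl <;> ring
  have h₁₂ := opFormI_eq_opFormII n hn₀ Q
  have h₁₃ := opFormI_eq_opFormIII n hn₀ Q ε hε₂
  have h₂₄ := opFormII_eq_opFormIV n hn₀ Q ε hε₂
  exact ⟨h₁₂, h₁₂.symm.trans h₁₃, h₁₃.symm.trans (h₁₂.trans h₂₄),
    middle_factorization n hn₀ Q ε hε₂⟩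
end
end

section
/- L(Q₁) = 0, where Q₁ is regarded as the K-valued function u ↦ Q₁(u); that is, the difference operator L annihilates the Baxter function Q₁. -/
attribute [local instance 10] Classical.propDecidable

noncomputable section

open Finset

variable {K : Type*} [CommRing K]

theorem opProd_append_singleton {K : Type*} [CommRing K]
    (l : List ((ℂ → K) → (ℂ → K))) (g : (ℂ → K) → (ℂ → K)) (f : ℂ → K) :
    opProd (l ++ [g]) f = opProd l (g f) := by
  induction l with
  | nil => rfl
  | cons h t ih => exact congrArg h ih

theorem opProd_zero {K : Type*} [CommRing K]
    (l : List ((ℂ → K) → (ℂ → K))) (hl : ∀ g ∈ l, g 0 = 0) : opProd l 0 = 0 := by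
  induction l with
  | nil => rfl
  | cons h t ih =>
    change h (opProd t 0) = 0
    rw [ih fun g hg => hl g (List.mem_cons_of_mem h hg)]
    exact hl h List.mem_cons_self

/-- The last coefficient of `L` is `Q₁(u+1) Q₁(u)⁻¹`. -/
theorem xq_last {K : Type*} [CommRing K] (n : ℕ) (hn : 2 ≤ n) (Q : ℕ → ℂ → Kˣ) (u : ℂ) :
    xq n Q (2 * n + 1 + 1) (u + (n : ℂ) - ((2 * n + 1 : ℕ) : ℂ)) =
      ((Q 1 (u + 1) * (Q 1 u)⁻¹ : Kˣ) : K) := by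
  have hminus : u + (n : ℂ) - (2 * n + 1) + (2 * n + 3) / 2 - 2⁻¹ = u := by ring
  have hplus : u + (n : ℂ) - (2 * n + 1) + (2 * n + 3) / 2 + 2⁻¹ = u + 1 := by ring
  have h_not_le : ¬ 2 * n + 1 + 1 ≤ n := by omega
  have h_ne_succ : 2 * n + 1 + 1 ≠ n + 1 := by omega
  have h_ne_add_two : 2 * n + 1 + 1 ≠ n + 2 := by omega
  have h_sub : 2 * n + 1 + 1 - 2 = 2 * n := by omega
  have h_not_le' : ¬ 2 * n ≤ n := by omega
  have h_one : 2 * n + 1 - 2 * n = 1 := by omega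
  have h_one_ne : 1 ≠ n := by omega
  rw [xq, if_neg h_not_le, if_neg h_ne_succ, if_neg h_ne_add_two, h_sub, zq, if_neg h_not_le',
    Nat.sub_self, h_one]
  simp only [Yq, if_true, one_ne_zero, if_false, h_one_ne]
  push_cast
  rw [hminus, hplus, one_mul, mul_inv_rev, inv_inv, Units.val_mul]

/-- The difference operator `L` annihilates the Baxter function `Q₁`. -/
theorem statement1 {K : Type*} [CommRing K] (n : ℕ) (hn : 2 ≤ n) (Q : ℕ → ℂ → Kˣ)
    (u : ℂ) :
    Lq n Q (fun v => (Q 1 v : K)) u = 0 := by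
  have hlast : (fun v : ℂ => xq n Q (2 * n + 1 + 1) (v + (n : ℂ) - ((2 * n + 1 : ℕ) : ℂ)) *
      (Q 1 v : K) - (Q 1 (v + 1) : K)) = 0 := by
    funext v
    rw [xq_last n hn Q v]
    simp
  rw [Lq, List.range_succ, List.map_append, List.map_singleton, opProd_append_singleton, hlast,
    opProd_zero]
  · rfl
  · intro g hg
    obtain ⟨j, -, rfl⟩ := List.mem_map.mp hg
    funext v
    simp
end
end

section
/- Weyl type formula for fundamental q-characters: for every 0 ≤ a ≤ N and u ∈ ℂ, [0,1,…,a−1,a+1,…,N](u) = T^{(a)}_1(u + a/2)·[1,2,…,N](u), where [c_1,…,c_N](u) = det(w_j(u + c_r))_{1≤j,r≤N}. In particular (the case a = N), [0,1,…,N−1](u) = −[1,2,…,N](u). -/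
attribute [local instance 10] Classical.propDecidable

noncomputable section

open Finset

variable {K : Type*} [CommRing K]

open scoped Matrix in
/-- Signed maximal minors of an `m × (m+1)` matrix are proportional to any vector of its kernel. -/
lemma det_submatrix_succAbove_mul_of_mulVec_eq_zero {R : Type*} [CommRing R] {m : ℕ}
    (W : Matrix (Fin m) (Fin (m + 1)) R) (y : Fin (m + 1) → R) (hy : W.mulVec y = 0)
    (a b : Fin (m + 1)) :
    (-1) ^ (a : ℕ) * (W.submatrix id a.succAbove).det * y b =
      (-1) ^ (b : ℕ) * (W.submatrix id b.succAbove).det * y a := by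
  set A : Matrix (Fin (m + 1)) (Fin (m + 1)) R :=
    Matrix.of (Fin.cons (Pi.single a 1) W)
  have hzero : A 0 = Pi.single a 1 := rfl
  have hrow : ∀ i, A (Fin.succ i) = W i := fun _ => rfl
  have hminor : ∀ i : Fin (m + 1),
      A.submatrix Fin.succ i.succAbove = W.submatrix id i.succAbove := fun i => by
    ext r s; simp [hrow]
  have hdet : A.det = (-1) ^ (a : ℕ) * (W.submatrix id a.succAbove).det := by
    rw [Matrix.det_succ_row_zero, Finset.sum_eq_single a]
    · simp [hzero, hminor a]
    · intro i _ hi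
      simp [hzero, Pi.single_eq_of_ne hi]
    · simp
  have hAy : A.mulVec y = Pi.single 0 (y a) := by
    ext i
    refine Fin.cases ?_ (fun i => ?_) i
    · change A 0 ⬝ᵥ y = _
      simp [hzero]
    · change A i.succ ⬝ᵥ y = _
      rw [hrow]
      exact (congrFun hy i).trans (by simp)
  have key : A.adjugate.mulVec (A.mulVec y) = A.det • y := by
    rw [Matrix.mulVec_mulVec, Matrix.adjugate_mul, Matrix.smul_mulVec, Matrix.one_mulVec]
  have hb := congrFun key b
  rw [hAy, Matrix.mulVec_single] at hb
  simp [Matrix.adjugate_fin_succ_eq_det_submatrix, hdet, hminor] at hb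
  exact hb.symm

lemma tabSumQ_zero (n : ℕ) (Q : ℕ → ℂ → Kˣ) (v : ℂ) : tabSumQ n Q 0 v = 1 := by
  rw [tabSumQ, Finset.filter_true_of_mem]
  · simp
  · exact fun t _ => ⟨fun k => k.elim0, fun k => k.elim0⟩

lemma T1q_zero (n : ℕ) (Q : ℕ → ℂ → Kˣ) (v : ℂ) : T1q n Q 0 v = 1 := by
  simp [T1q, tabSumQ_zero]

lemma T1q_top (n : ℕ) (Q : ℕ → ℂ → Kˣ) (v : ℂ) :
    T1q n Q ((2 * n + 2 : ℕ) : ℤ) v = -1 := by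
  rw [T1q, if_neg (by omega), if_neg (by omega), if_neg (by omega), if_pos (by omega),
    show (2 * (n : ℤ) + 2 - ((2 * n + 2 : ℕ) : ℤ)).toNat = 0 by omega, tabSumQ_zero]

/-- Proposition 2.6 (Weyl type formula for fundamental q-characters): if
`w_1, …, w_N` solve the linear difference equation
`w(u+N) = ∑_{i=0}^{N-1} (-1)^i T^{(i)}_1(u+i/2) w(u+i)`, then for `0 ≤ a ≤ N`,
`[0,…,a-1,a+1,…,N](u) = T^{(a)}_1(u+a/2) ⋅ [1,…,N](u)`. -/
theorem statement5 {K : Type*} [CommRing K] (n : ℕ) (hn : 2 ≤ n) (Q : ℕ → ℂ → Kˣ)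
    (w : Fin (2 * n + 2) → ℂ → K)
    (hw : ∀ (j : Fin (2 * n + 2)) (u : ℂ),
      w j (u + ((2 * n + 2 : ℕ) : ℂ)) =
        ∑ i ∈ Finset.range (2 * n + 2),
          (-1 : K) ^ i * T1q n Q i (u + (i : ℂ) / 2) * w j (u + (i : ℂ)))
    (a : ℕ) (ha : a ≤ 2 * n + 2) (u : ℂ) :
    Matrix.det (Matrix.of fun j r : Fin (2 * n + 2) =>
        w j (u + ((if (r : ℕ) < a then (r : ℕ) else (r : ℕ) + 1 : ℕ) : ℂ))) =
      T1q n Q a (u + (a : ℂ) / 2) *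
        Matrix.det (Matrix.of fun j r : Fin (2 * n + 2) =>
          w j (u + (((r : ℕ) + 1 : ℕ) : ℂ))) := by
  set W : Matrix (Fin (2 * n + 2)) (Fin (2 * n + 2 + 1)) K :=
    Matrix.of fun j i => w j (u + ((i : ℕ) : ℂ)) with hW
  set y : Fin (2 * n + 2 + 1) → K :=
    fun i => (-1) ^ (i : ℕ) * T1q n Q (i : ℕ) (u + ((i : ℕ) : ℂ) / 2) with hy
  have hker : W.mulVec y = 0 := by
    ext j
    have hsum : W.mulVec y j = ∑ i ∈ Finset.range (2 * n + 2 + 1),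
        (-1 : K) ^ i * T1q n Q i (u + (i : ℂ) / 2) * w j (u + (i : ℂ)) := by
      rw [Finset.sum_range]
      change ∑ i, W j i * y i = _
      exact Finset.sum_congr rfl fun i _ => mul_comm (W j i) (y i)
    have hsign : (-1 : K) ^ (2 * n + 2) = 1 := Even.neg_one_pow ⟨n + 1, by ring⟩
    rw [hsum, Finset.sum_range_succ, ← hw j u, T1q_top, hsign]
    simp
  have key := det_submatrix_succAbove_mul_of_mulVec_eq_zero W y hker
    ⟨a, Nat.lt_succ_of_le ha⟩ 0
  have hy0 : y 0 = 1 := by simp [hy, T1q_zero]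
  have hsq : ((-1 : K) ^ a) * (-1) ^ a = 1 := by rw [← mul_pow]; simp
  have hminor : W.submatrix id (Fin.succAbove ⟨a, Nat.lt_succ_of_le ha⟩) =
      Matrix.of fun j r : Fin (2 * n + 2) =>
        w j (u + ((if (r : ℕ) < a then (r : ℕ) else (r : ℕ) + 1 : ℕ) : ℂ)) := by
    ext j r
    by_cases h : (r : ℕ) < a <;> simp [hW, Fin.succAbove, Fin.lt_def, h]
  have hminor_zero : W.submatrix id (Fin.succAbove 0) =
      Matrix.of fun j r : Fin (2 * n + 2) => w j (u + (((r : ℕ) + 1 : ℕ) : ℂ)) := by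
    ext j r
    simp [hW]
  rw [hminor, hminor_zero, hy0] at key
  simp only [hy, Fin.val_zero, pow_zero, one_mul, mul_one] at key
  linear_combination (-1 : K) ^ a * key -
    (Matrix.det (Matrix.of fun j r : Fin (2 * n + 2) =>
        w j (u + ((if (r : ℕ) < a then (r : ℕ) else (r : ℕ) + 1 : ℕ) : ℂ))) -
      T1q n Q a (u + (a : ℂ) / 2) *
        Matrix.det (Matrix.of fun j r : Fin (2 * n + 2) =>
          w j (u + (((r : ℕ) + 1 : ℕ) : ℂ)))) * hsq
end
end
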